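/- arXiv:1001.1437 — 2 statements merged into one kernel-verified Lean document; each statement's English description precedes it below -/
import Mathlib

section
/- Let φ, y, ρ, H : ℝ → ℝ be differentiable functions satisfying on [t₀, ∞) the system φ' = y, y' = -3Hy - V'(φ) + αρ, ρ' = -3γρH - αρy, H' = -½y² - (γ/2)ρ, and let W(t) = H(t)² - (1/3)(½y(t)² + V(φ(t)) + ρ(t)). If W(t₀) = 0, then W(t) = 0 for all t ≥ t₀; that is, the hypersurface {W = 0} representing flat (k = 0) cosmologies is invariant under the flow. -/
/-- The hypersurface {W = 0} of flat (k = 0) cosmologies is invariant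
under the flow of the FRW scalar-field/fluid system: if the Friedmann constraint
W(t₀) = 0 holds initially, it holds for all t ≥ t₀. -/
theorem stmt_1 (γ α : ℝ) (hγ : 0 < γ) (hγ2 : γ ≤ 2)
    (hα : α = (4 - 3 * γ) / Real.sqrt 6)
    (V : ℝ → ℝ) (hV : ContDiff ℝ 1 V)
    (t₀ : ℝ) (φ y ρ H : ℝ → ℝ)
    (hφ : ∀ t ∈ Set.Ici t₀, HasDerivAt φ (y t) t)
    (hy : ∀ t ∈ Set.Ici t₀, HasDerivAt y (-3 * H t * y t - deriv V (φ t) + α * ρ t) t)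
    (hρ : ∀ t ∈ Set.Ici t₀, HasDerivAt ρ (-3 * γ * ρ t * H t - α * ρ t * y t) t)
    (hH : ∀ t ∈ Set.Ici t₀, HasDerivAt H (-(1/2) * y t ^ 2 - γ / 2 * ρ t) t)
    (W : ℝ → ℝ)
    (hW : W = fun t => H t ^ 2 - (1/3) * ((1/2) * y t ^ 2 + V (φ t) + ρ t))
    (hW0 : W t₀ = 0) :
    ∀ t ∈ Set.Ici t₀, W t = 0 := by
  have hWd : ∀ t ∈ Set.Ici t₀, HasDerivAt W 0 t := by
    intro t ht
    have hVφ : HasDerivAt (fun s => V (φ s)) (deriv V (φ t) * y t) t :=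
      ((hV.differentiable one_ne_zero) (φ t)).hasDerivAt.comp t (hφ t ht)
    rw [hW]
    refine (((hH t ht).fun_pow 2).fun_sub (((((hy t ht).fun_pow 2).const_mul (1 / 2)).fun_add
      hVφ |>.fun_add (hρ t ht)).const_mul (1 / 3))).congr_deriv ?_
    push_cast
    ring
  intro t ht
  rw [← hW0]
  exact constant_of_has_deriv_right_zero
    (fun s hs => (hWd s hs.1).continuousAt.continuousWithinAt)
    (fun s hs => (hWd s hs.1).hasDerivWithinAt) t ⟨ht, le_rfl⟩
end

section
/- Let φ, y, ρ, H : ℝ → ℝ be differentiable functions satisfying on [t₀, ∞) the system φ' = y, y' = -3Hy - V'(φ) + αρ, ρ' = -3γρH - αρy, H' = -½y² - (γ/2)ρ, and let W(t) = H(t)² - (1/3)(½y(t)² + V(φ(t)) + ρ(t)). Then the sign of W is invariant under the flow: if W(t₀) > 0 then W(t) > 0 for all t ≥ t₀, and if W(t₀) < 0 then W(t) < 0 for all t ≥ t₀. -/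
/-- The sign of the constraint function W = H² - (1/3)(½y² + V(φ) + ρ)
is invariant under the flow of the FRW scalar-field/fluid system: if W(t₀) > 0 then
W stays positive, and if W(t₀) < 0 then W stays negative, for all t ≥ t₀. -/
theorem stmt_2 (γ α : ℝ) (hγ : 0 < γ) (hγ2 : γ ≤ 2)
    (hα : α = (4 - 3 * γ) / Real.sqrt 6)
    (V : ℝ → ℝ) (hV : ContDiff ℝ 1 V)
    (t₀ : ℝ) (φ y ρ H : ℝ → ℝ)
    (hφ : ∀ t ∈ Set.Ici t₀, HasDerivAt φ (y t) t)
    (hy : ∀ t ∈ Set.Ici t₀, HasDerivAt y (-3 * H t * y t - deriv V (φ t) + α * ρ t) t)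
    (hρ : ∀ t ∈ Set.Ici t₀, HasDerivAt ρ (-3 * γ * ρ t * H t - α * ρ t * y t) t)
    (hH : ∀ t ∈ Set.Ici t₀, HasDerivAt H (-(1/2) * y t ^ 2 - γ / 2 * ρ t) t)
    (W : ℝ → ℝ)
    (hW : W = fun t => H t ^ 2 - (1/3) * ((1/2) * y t ^ 2 + V (φ t) + ρ t)) :
    (W t₀ > 0 → ∀ t ∈ Set.Ici t₀, W t > 0) ∧
    (W t₀ < 0 → ∀ t ∈ Set.Ici t₀, W t < 0) := by
  have hconst : ∀ t ∈ Set.Ici t₀, W t = W t₀ := by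
    have hderiv : ∀ t ∈ Set.Ici t₀, HasDerivAt W 0 t := by
      intro t ht
      have hVφ : HasDerivAt (fun s => V (φ s)) (deriv V (φ t) * y t) t :=
        ((hV.differentiable one_ne_zero (φ t)).hasDerivAt).comp t (hφ t ht)
      rw [hW]
      refine (((hH t ht).pow 2).sub
        (((((hy t ht).pow 2).const_mul (1/2)).add hVφ |>.add (hρ t ht)).const_mul
          (1/3))).congr_deriv ?_
      push_cast
      ring
    intro t ht
    exact constant_of_has_deriv_right_zero
      (fun s hs => (hderiv s hs.1).continuousAt.continuousWithinAt)
      (fun s hs => (hderiv s hs.1).hasDerivWithinAt) t ⟨ht, le_rfl⟩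
  exact ⟨fun h t ht => (hconst t ht).symm ▸ h, fun h t ht => (hconst t ht).symm ▸ h⟩
end
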